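/- Let d ≥ 1 and let φ : (0,∞) → [0,∞) be a function satisfying φ(R) ≥ ((R−r)^d / r^d) · φ(r) for all 0 < r < R. If η := limsup_{R→∞} φ(R)/R^d < ∞, then the limit lim_{R→∞} φ(R)/R^d exists and equals η. -/

import Mathlib

open Filter

/-- if `φ : (0,∞) → [0,∞)` satisfies the superadditivity-type inequality
`φ(R) ≥ ((R−r)^d / r^d) · φ(r)` for all `0 < r < R`, and
`η := limsup_{R→∞} φ(R)/R^d < ∞`, then `lim_{R→∞} φ(R)/R^d` exists and equals `η`. -/
theorem limsup_is_limit_of_superadditive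
    (d : ℕ) (hd : 1 ≤ d) (φ : ℝ → ℝ)
    (hnonneg : ∀ R : ℝ, 0 < R → 0 ≤ φ R)
    (hsuper : ∀ r R : ℝ, 0 < r → r < R → ((R - r) ^ d / r ^ d) * φ r ≤ φ R)
    (hbdd : IsBoundedUnder (· ≤ ·) atTop (fun R : ℝ => φ R / R ^ d))
    (η : ℝ) (hη : limsup (fun R : ℝ => φ R / R ^ d) atTop = η) :
    Tendsto (fun R : ℝ => φ R / R ^ d) atTop (nhds η) := by
  have hbelow : IsBoundedUnder (· ≥ ·) atTop (fun R : ℝ => φ R / R ^ d) := by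
    refine isBoundedUnder_of_eventually_ge (a := 0) ?_
    filter_upwards [eventually_gt_atTop 0] with R hR
    exact div_nonneg (hnonneg R hR) (by positivity)
  refine tendsto_order.2 ⟨fun a ha => ?_, fun a ha => ?_⟩
  · have hfreq : ∃ᶠ R in atTop, a < φ R / R ^ d :=
      frequently_lt_of_lt_limsup hbelow.isCoboundedUnder_le (hη ▸ ha)
    obtain ⟨r, har, hr⟩ := (hfreq.and_eventually (eventually_gt_atTop 0)).exists
    have hlim : Tendsto (fun R : ℝ => (1 - r / R) ^ d * (φ r / r ^ d)) atTop
        (nhds (φ r / r ^ d)) := by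
      simpa using (((tendsto_const_nhds (x := r)).div_atTop tendsto_id).const_sub 1 |>.pow d
        |>.mul_const (φ r / r ^ d))
    filter_upwards [hlim.eventually_const_lt har, eventually_gt_atTop r] with R haR hrR
    have hR : 0 < R := hr.trans hrR
    refine haR.trans_le ?_
    rw [le_div_iff₀ (by positivity)]
    refine le_of_eq_of_le ?_ (hsuper r R hr hrR)
    rw [one_sub_div hR.ne', div_pow]
    field_simp
  · exact eventually_lt_of_limsup_lt (hη ▸ ha) hbdd
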